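/- arXiv:2006.06241 — 3 statements merged into one kernel-verified Lean document; each statement's English description precedes it below -/
import Mathlib

section
/- Let λ and μ be partitions, let τ ≥ 0 and k be integers with 0 ≤ k ≤ λ_1, and let [M'; L'] = θ_k(λ, μ) (the ε = + construction). Then for every bipartition [M''; L''] belonging to Θ^{+,τ}_k(λ, μ) and for every s ≥ 1 and t ≥ 1 one has M''_1 + M''_2 + ⋯ + M''_s ≥ M'_1 + M'_2 + ⋯ + M'_s and L''_1 + L''_2 + ⋯ + L''_t ≥ L'_1 + L'_2 + ⋯ + L'_t. -/
/-- The weakly decreasing rearrangement of a weakly decreasing sequence `f`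
with one extra part `t` inserted. -/
def insertPart (t : ℕ) (f : ℕ → ℕ) : ℕ → ℕ
  | 0 => max (f 0) t
  | n + 1 => max (min (f n) t) (f (n + 1))

/-- A partition: a weakly decreasing sequence of naturals with
finitely many nonzero terms. -/
def IsPartition (f : ℕ → ℕ) : Prop := Antitone f ∧ ∃ N, ∀ n, N ≤ n → f n = 0

/-- The size `‖f‖` of a partition: the sum of its parts. -/
noncomputable def psize (f : ℕ → ℕ) : ℕ := ∑ᶠ n, f n

/-- Membership of the bipartition `[M; L]` in `Θ^{+,τ}_k(λ,μ)`:
`M_i ≥ μ_i ≥ M_{i+1}`, `λ_i ≥ L_i ≥ λ_{i+1}` for all `i`, with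
`‖M‖ = ‖μ‖ + τ + k` and `‖L‖ = ‖λ‖ - k`.  (All sequences are 0-indexed.) -/
def ThetaPlusMem (τ k : ℕ) (lam mu M L : ℕ → ℕ) : Prop :=
  IsPartition M ∧ IsPartition L ∧
  (∀ i, mu i ≤ M i ∧ M (i + 1) ≤ mu i) ∧
  (∀ i, L i ≤ lam i ∧ lam (i + 1) ≤ L i) ∧
  psize M = psize mu + τ + k ∧ psize L + k = psize lam

/-- Membership of the bipartition `[M; L]` in `Θ^{-,τ}_k(λ,μ)`:
`μ_i ≥ M_i ≥ μ_{i+1}`, `L_i ≥ λ_i ≥ L_{i+1}` for all `i`, with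
`‖M‖ = ‖μ‖ - k` and `‖L‖ = ‖λ‖ + τ + k`.  (All sequences are 0-indexed.) -/
def ThetaMinusMem (τ k : ℕ) (lam mu M L : ℕ → ℕ) : Prop :=
  IsPartition M ∧ IsPartition L ∧
  (∀ i, M i ≤ mu i ∧ mu (i + 1) ≤ M i) ∧
  (∀ i, lam i ≤ L i ∧ L (i + 1) ≤ lam i) ∧
  psize M + k = psize mu ∧ psize L = psize lam + τ + k

/-- Lexicographic order on sequences: `f` strictly precedes `g`. -/
def LexLt (f g : ℕ → ℕ) : Prop := ∃ i, (∀ j, j < i → f j = g j) ∧ f i < g i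

theorem sum_range_succ_insertPart (t : ℕ) {f : ℕ → ℕ} (hf : Antitone f) (s : ℕ) :
    ∑ i ∈ Finset.range (s + 1), insertPart t f i =
      ∑ i ∈ Finset.range s, f i + max (f s) t := by
  induction s with
  | zero => simp [insertPart]
  | succ s ih =>
    rw [Finset.sum_range_succ, ih, Finset.sum_range_succ f]
    have := hf (Nat.le_succ s)
    simp only [insertPart, Nat.succ_eq_add_one] at this ⊢
    omega

theorem IsPartition.psize_eq_sum_range {f : ℕ → ℕ} (hf : IsPartition f) :
    ∃ N, ∀ n, N ≤ n → psize f = ∑ i ∈ Finset.range n, f i := by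
  obtain ⟨-, N, hN⟩ := hf
  refine ⟨N, fun n hn => finsum_eq_sum_of_support_subset f fun i hi => ?_⟩
  by_contra h
  exact hi (hN i (hn.trans (by simpa using h)))

/-- Among the sequences interlacing `f` from above with total `t` larger than that of `f`,
the one obtained by inserting `t` has minimal partial sums. -/
theorem sum_range_insertPart_le {t : ℕ} {f g : ℕ → ℕ} (hf : Antitone f)
    (hfg : ∀ i, f i ≤ g i) (hgf : ∀ i, g (i + 1) ≤ f i)
    (hsum : ∃ N, ∀ n, N ≤ n →
      ∑ i ∈ Finset.range n, f i + t = ∑ i ∈ Finset.range (n + 1), g i) (s : ℕ) :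
    ∑ i ∈ Finset.range s, insertPart t f i ≤ ∑ i ∈ Finset.range s, g i := by
  cases s with
  | zero => simp
  | succ s =>
    have tail : ∀ d, ∑ i ∈ Finset.range (s + d + 1), g i + ∑ i ∈ Finset.range s, f i ≤
        ∑ i ∈ Finset.range (s + 1), g i + ∑ i ∈ Finset.range (s + d), f i := by
      intro d
      induction d with
      | zero => simp
      | succ d ih =>
        rw [← add_assoc, Finset.sum_range_succ g, Finset.sum_range_succ f (s + d)]
        have := hgf (s + d)
        omega
    obtain ⟨N, hN⟩ := hsum
    have htotal := hN (s + N) (Nat.le_add_left N s)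
    have htail := tail N
    have hle : ∑ i ∈ Finset.range (s + 1), f i ≤ ∑ i ∈ Finset.range (s + 1), g i :=
      Finset.sum_le_sum fun i _ => hfg i
    rw [Finset.sum_range_succ f] at hle
    rw [sum_range_succ_insertPart t hf]
    omega

/-- Lemma 0418, case ε = +: the bipartition `θ_k(λ,μ)` has minimal partial sums
in both rows among all members of `Θ^{+,τ}_k(λ,μ)`. -/
theorem stmt0 (τ k : ℕ) (lam mu : ℕ → ℕ)
    (hlam : IsPartition lam) (hmu : IsPartition mu) (hk : k ≤ lam 0)
    (M' L' : ℕ → ℕ)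
    (hM' : M' = insertPart (τ + k) mu)
    (hL' : L' = insertPart (lam 0 - k) fun n => lam (n + 1))
    (M'' L'' : ℕ → ℕ) (hmem : ThetaPlusMem τ k lam mu M'' L'') :
    (∀ s : ℕ, ∑ i ∈ Finset.range s, M' i ≤ ∑ i ∈ Finset.range s, M'' i) ∧
    (∀ t : ℕ, ∑ i ∈ Finset.range t, L' i ≤ ∑ i ∈ Finset.range t, L'' i) := by
  obtain ⟨hM, hL, hMmu, hLlam, hMsize, hLsize⟩ := hmem
  obtain ⟨N₁, h₁⟩ := hlam.psize_eq_sum_range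
  obtain ⟨N₂, h₂⟩ := hmu.psize_eq_sum_range
  obtain ⟨N₃, h₃⟩ := hM.psize_eq_sum_range
  obtain ⟨N₄, h₄⟩ := hL.psize_eq_sum_range
  subst hM' hL'
  constructor
  · refine sum_range_insertPart_le hmu.1 (fun i => (hMmu i).1) (fun i => (hMmu i).2)
      ⟨N₂ + N₃, fun n hn => ?_⟩
    rw [← h₂ n (by omega), ← h₃ (n + 1) (by omega)]
    omega
  · refine sum_range_insertPart_le (fun i j hij => hlam.1 (Nat.succ_le_succ hij))
      (fun i => (hLlam i).2) (fun i => (hLlam (i + 1)).1) ⟨N₁ + N₄, fun n hn => ?_⟩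
    have hlamsum := h₁ (n + 1) (by omega)
    rw [Finset.sum_range_succ'] at hlamsum
    rw [← h₄ (n + 1) (by omega)]
    omega
end

section
/- Let μ_1 ≥ μ_2 ≥ ⋯ ≥ μ_m ≥ 0 be natural numbers. For each natural number t, let I(t) be the weakly decreasing rearrangement of the list (μ_1, …, μ_m, t), and define the strictly decreasing sequence σ(t) of length m+1 by σ(t)_p = I(t)_p + (m + 1 − p). Then for every t there is exactly one index p(t) ∈ {1, …, m+1} such that σ(t+1)_{p(t)} = σ(t)_{p(t)} + 1 while σ(t+1)_q = σ(t)_q for all q ≠ p(t); moreover, setting α(t) = σ(t)_{p(t)}, the sequence t ↦ α(t) is strictly increasing. -/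
/-- Where `f` first drops to at most `t`, the inserted part is `t` itself. -/
theorem insertPart_eq_self {f : ℕ → ℕ} {t p : ℕ} (hp : f p ≤ t) (hlt : ∀ q < p, t ≤ f q) :
    insertPart t f p = t := by
  cases p with
  | zero => simp [insertPart, hp]
  | succ n => simp [insertPart, hp, hlt n n.lt_succ_self]

/-- Before the inserted part, the sequence is unchanged. -/
theorem insertPart_eq_of_le {f : ℕ → ℕ} {t p : ℕ} (hp : t ≤ f p) :
    insertPart t f p = f p := by
  cases p with
  | zero => simp [insertPart, hp]
  | succ n => simp [insertPart, hp]

/-- After the inserted part, the sequence is shifted by one. -/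
theorem insertPart_succ_eq_of_le {f : ℕ → ℕ} {t p : ℕ} (hf : Antitone f) (hp : f p ≤ t) :
    insertPart t f (p + 1) = f p := by
  simp [insertPart, hp, hf p.le_succ]

theorem antitone_insertPart {f : ℕ → ℕ} (hf : Antitone f) (t : ℕ) :
    Antitone (insertPart t f) := by
  refine antitone_nat_of_succ_le fun n => ?_
  have h := hf n.le_succ
  cases n <;> simp only [insertPart] <;> grind

/-- First-row mechanism: passing from the insertion of `t` to the insertion of
`t+1` into `μ_1 ≥ ⋯ ≥ μ_m`, exactly one entry of the associated strictly
decreasing sequence `σ(t)` (0-indexed, `σ(t)_p = I(t)_p + (m - p)` for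
`0 ≤ p ≤ m`) increases by `1`, all others are unchanged, and the changed
values form a strictly increasing sequence in `t`. -/
theorem stmt4 (m : ℕ) (mu : ℕ → ℕ)
    (hmu : ∀ p q, p ≤ q → q < m → mu q ≤ mu p)
    (hmu0 : ∀ p, m ≤ p → mu p = 0)
    (σ : ℕ → ℕ → ℕ)
    (hσ : ∀ t p, σ t p = insertPart t mu p + (m - p)) :
    (∀ t p q, p < q → q ≤ m → σ t q < σ t p) ∧
    ∃ idx : ℕ → ℕ, (∀ t, idx t ≤ m) ∧
      (∀ t, σ (t + 1) (idx t) = σ t (idx t) + 1) ∧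
      (∀ t q, q ≤ m → q ≠ idx t → σ (t + 1) q = σ t q) ∧
      StrictMono fun t => σ t (idx t) := by
  have hanti : Antitone mu := by
    intro p q hpq
    rcases lt_or_ge q m with hq | hq
    · exact hmu p q hpq hq
    · simp [hmu0 q hq]
  have hex : ∀ t, ∃ p, mu p ≤ t := fun t => ⟨m, by simp [hmu0 m le_rfl]⟩
  have hle : ∀ t, Nat.find (hex t) ≤ m := fun t => Nat.find_min' _ (by simp [hmu0 m le_rfl])
  have hspec : ∀ t, mu (Nat.find (hex t)) ≤ t := fun t => Nat.find_spec (hex t)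
  have hmin : ∀ t, ∀ q < Nat.find (hex t), t + 1 ≤ mu q :=
    fun t q hq => not_le.mp (Nat.find_min (hex t) hq)
  have hself : ∀ t, insertPart t mu (Nat.find (hex t)) = t := fun t =>
    insertPart_eq_self (hspec t) fun q hq => (Nat.le_succ t).trans (hmin t q hq)
  refine ⟨fun t p q hpq hq => ?_, fun t => Nat.find (hex t), hle, fun t => ?_,
    fun t q _ hne => ?_, strictMono_nat_of_lt_succ fun t => ?_⟩
  · have := antitone_insertPart hanti t hpq.le
    rw [hσ, hσ]
    omega
  · rw [hσ, hσ, hself, insertPart_eq_self ((hspec t).trans t.le_succ) (hmin t)]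
    omega
  · rw [hσ, hσ]
    rcases lt_or_gt_of_ne hne with hlt | hgt
    · have h := hmin t q hlt
      rw [insertPart_eq_of_le h, insertPart_eq_of_le (t.le_succ.trans h)]
    · obtain ⟨n, rfl⟩ := Nat.exists_eq_add_one_of_ne_zero (Nat.ne_zero_of_lt hgt)
      have h : mu n ≤ t := (hanti (Nat.lt_succ_iff.mp hgt)).trans (hspec t)
      rw [insertPart_succ_eq_of_le hanti h, insertPart_succ_eq_of_le hanti (h.trans t.le_succ)]
  · have : Nat.find (hex (t + 1)) ≤ Nat.find (hex t) :=
      Nat.find_min' _ ((hspec t).trans t.le_succ)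
    simp only [hσ, hself]
    omega
end

section
/- Let a_1 > a_2 > ⋯ > a_{m_1} ≥ 0 and b_1 > b_2 > ⋯ > b_{m_2} ≥ 0 be strictly decreasing sequences of natural numbers, and set λ_i = a_i − (m_1 − i) for 1 ≤ i ≤ m_1 and μ_j = b_j − (m_2 − j) for 1 ≤ j ≤ m_2 (so λ and μ are weakly decreasing sequences of natural numbers). Let τ ≥ 0 and 0 ≤ k ≤ λ_1, let j be the least index in {1, …, m_2 + 1} such that either j = m_2 + 1 or τ + k ≥ μ_j, and let i be the least index in {2, …, m_1 + 1} such that either i = m_1 + 1 or λ_1 − k > λ_i. Then the sequence c = (b_1 + 1, …, b_{j−1} + 1, τ + k + m_2 + 1 − j, b_j, …, b_{m_2}) of length m_2 + 1 and the sequence d = (a_2 + 1, …, a_{i−1} + 1, λ_1 − k + m_1 − i + 1, a_i, …, a_{m_1}) of length m_1 are strictly decreasing sequences of natural numbers, and the bipartition with top row (c_p − (m_2 + 1 − p))_{1 ≤ p ≤ m_2+1} and bottom row (d_q − (m_1 − q))_{1 ≤ q ≤ m_1} equals θ_k(λ, μ), i.e., its top row is the weakly decreasing rearrangement of μ with one extra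 part τ + k inserted and its bottom row is the weakly decreasing rearrangement of (λ_2, …, λ_{m_1}) with one extra part λ_1 − k inserted. -/
/-- A strictly decreasing sequence of `m` naturals dominates its staircase. -/
lemma staircase_le {m : ℕ} {b : ℕ → ℕ} (hb : ∀ p q, p < q → q < m → b q < b p) {p : ℕ}
    (hp : p < m) : m - 1 - p ≤ b p := by
  obtain ⟨r, rfl⟩ : ∃ r, m = p + 1 + r := ⟨m - (p + 1), by omega⟩
  induction r generalizing p with
  | zero => omega
  | succ r ih =>
    have h₁ := hb p (p + 1) (by omega) (by omega)
    have h₂ := ih (p := p + 1) (fun x y hxy hy => hb x y hxy (by omega)) (by omega)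
    omega

/-- Subtracting the staircase from a strictly decreasing sequence, and extending by zero,
gives a weakly decreasing sequence. -/
lemma antitone_sub_staircase {m : ℕ} {b f : ℕ → ℕ} (hb : ∀ p q, p < q → q < m → b q < b p)
    (hf : ∀ p, f p = if p < m then b p - (m - 1 - p) else 0) : Antitone f := by
  refine antitone_nat_of_succ_le fun p => ?_
  rw [hf p, hf (p + 1)]
  split_ifs with h₁ h₂
  · have := hb p (p + 1) (by omega) h₁
    omega
  all_goals omega

/-- The value of `insertPart` for a weakly decreasing sequence, in terms of a cut index `j`
at which the extra part may be placed. -/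
lemma insertPart_of_cut {t j : ℕ} {f : ℕ → ℕ} (hf : Antitone f) (hle : f j ≤ t)
    (hge : ∀ p, p < j → t ≤ f p) (p : ℕ) :
    insertPart t f p = if p < j then f p else if p = j then t else f (p - 1) := by
  rcases p with _ | p
  · split_ifs with h₁ h₂
    · exact max_eq_left (hge 0 h₁)
    · subst h₂
      exact max_eq_right hle
    · omega
  · have hstep : f (p + 1) ≤ f p := hf (Nat.le_succ p)
    simp only [insertPart, Nat.add_sub_cancel]
    split_ifs with h₁ h₂
    · have := hge (p + 1) h₁
      omega
    · have := hge p (by omega)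
      subst h₂
      omega
    · have : f p ≤ t := (hf (by omega)).trans hle
      omega

/-- Inserting an entry in a strictly decreasing sequence of `m` naturals, raising by one the
entries before it, amounts to inserting a part in the associated weakly decreasing sequence. -/
lemma insert_entry {m t j : ℕ} {b f c : ℕ → ℕ} (hb : ∀ p q, p < q → q < m → b q < b p)
    (hf : ∀ p, f p = if p < m then b p - (m - 1 - p) else 0)
    (hj : j ≤ m) (hle : j < m → f j ≤ t) (hge : ∀ p, p < j → t ≤ f p)
    (hc : ∀ p, p ≤ m →
      c p = if p < j then b p + 1 else if p = j then t + m - j else b (p - 1)) :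
    (∀ p q, p < q → q ≤ m → c q < c p) ∧
      ∀ p, p ≤ m → c p - (m - p) = insertPart t f p := by
  have hanti := antitone_sub_staircase hb hf
  have hle' : f j ≤ t := by
    by_cases h : j < m
    · exact hle h
    · simp [hf j, h]
  have hb' : ∀ p, p < m → b p = f p + (m - 1 - p) := fun p hp => by
    have := staircase_le hb hp
    rw [hf p, if_pos hp]
    omega
  have hcf : ∀ p, p ≤ m → c p = insertPart t f p + (m - p) := fun p hp => by
    rw [hc p hp, insertPart_of_cut hanti hle' hge]
    split_ifs with h₁ h₂
    · rw [hb' p (by omega)]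
      omega
    · omega
    · rw [hb' (p - 1) (by omega)]
      omega
  have hins : Antitone (insertPart t f) := by
    refine antitone_nat_of_succ_le fun p => ?_
    have h₁ : f (p + 1) ≤ f p := hanti (Nat.le_succ p)
    cases p <;> simp only [insertPart] <;> omega
  refine ⟨fun p q hpq hq => ?_, fun p hp => by rw [hcf p hp, Nat.add_sub_cancel]⟩
  have := hins hpq.le
  rw [hcf p (by omega), hcf q hq]
  omega

/-- The symbol formula for `θ_k` (ε = +): if `Λ = (a_1 > ⋯ > a_{m₁}; b_1 > ⋯ > b_{m₂})`
is a symbol with `Υ(Λ) = (λ; μ)` (0-indexed: `λ_p = a_p - (m₁ - 1 - p)`,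
`μ_p = b_p - (m₂ - 1 - p)`), and `i, j` are the cut indices (0-indexed: `j` is
least in `{0,…,m₂}` with `j = m₂` or `τ + k ≥ μ_j`; `i` is least in
`{1,…,m₁}` with `i = m₁` or `λ_1 - k > λ_i`), then the displayed rows
`c = (b_1+1,…,b_{j-1}+1, τ+k+m₂+1-j, b_j,…,b_{m₂})` and
`d = (a_2+1,…,a_{i-1}+1, λ_1-k+m₁-i+1, a_i,…,a_{m₁})` are strictly decreasing,
and the symbol `(c; d)` corresponds under `Υ` to the bipartition `θ_k(λ,μ)`. -/
theorem stmt15 (m₁ m₂ τ k : ℕ) (hm₁ : 1 ≤ m₁)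
    (a b : ℕ → ℕ)
    (ha : ∀ p q, p < q → q < m₁ → a q < a p)
    (hb : ∀ p q, p < q → q < m₂ → b q < b p)
    (lam mu : ℕ → ℕ)
    (hlam : ∀ p, lam p = if p < m₁ then a p - (m₁ - 1 - p) else 0)
    (hmu : ∀ p, mu p = if p < m₂ then b p - (m₂ - 1 - p) else 0)
    (hk : k ≤ lam 0)
    (j : ℕ) (hj1 : j ≤ m₂) (hj2 : j < m₂ → mu j ≤ τ + k)
    (hj3 : ∀ p, p < j → τ + k < mu p)
    (i : ℕ) (hi0 : 1 ≤ i) (hi1 : i ≤ m₁) (hi2 : i < m₁ → lam i < lam 0 - k)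
    (hi3 : ∀ p, 1 ≤ p → p < i → lam 0 - k ≤ lam p)
    (c d : ℕ → ℕ)
    (hc : ∀ p, c p = if p < j then b p + 1
                     else if p = j then τ + k + m₂ - j else b (p - 1))
    (hd : ∀ p, d p = if p + 1 < i then a (p + 1) + 1
                     else if p + 1 = i then lam 0 - k + m₁ - i else a p) :
    (∀ p q, p < q → q ≤ m₂ → c q < c p) ∧
    (∀ p q, p < q → q < m₁ → d q < d p) ∧
    (∀ p, p ≤ m₂ → c p - (m₂ - p) = insertPart (τ + k) mu p) ∧
    (∀ q, q < m₁ →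
      d q - (m₁ - 1 - q) = insertPart (lam 0 - k) (fun n => lam (n + 1)) q) := by
  obtain ⟨m, rfl⟩ : ∃ m, m₁ = m + 1 := ⟨m₁ - 1, by omega⟩
  obtain ⟨i, rfl⟩ : ∃ i', i = i' + 1 := ⟨i - 1, by omega⟩
  obtain ⟨hc₁, hc₂⟩ := insert_entry hb hmu hj1 hj2 (fun p hp => (hj3 p hp).le) fun p _ => hc p
  obtain ⟨hd₁, hd₂⟩ := insert_entry (m := m) (t := lam 0 - k) (j := i)
    (b := fun n => a (n + 1)) (f := fun n => lam (n + 1)) (c := d)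
    (fun p q hpq hq => ha _ _ (by omega) (by omega))
    (fun p => by
      simp only [hlam (p + 1), Nat.add_lt_add_iff_right, Nat.add_sub_cancel, Nat.sub_sub,
        Nat.add_comm 1 p])
    (by omega) (fun h => (hi2 (by omega)).le) (fun p hp => hi3 _ (by omega) (by omega))
    (fun p _ => by
      rw [hd p]
      split_ifs <;> first | omega | rfl | rw [Nat.sub_add_cancel (by omega)])
  exact ⟨hc₁, fun p q hpq hq => hd₁ p q hpq (by omega), hc₂, fun q hq => hd₂ q (by omega)⟩
end
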